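/- arXiv:0805.3200 — 4 statements merged into one kernel-verified Lean document; each statement's English description precedes it below -/
import Mathlib

section
/- Let A ⊆ M with |A| ≥ 2, let R ∈ ℛ(A), let 2 ≤ k ≤ |A|, and let (C_1,…,C_k) ∈ 𝒫_k(A). Then ∑_{j∈M} R_j ≥ h(M) − I(C_1,…,C_k), where I(C_1,…,C_k) = (∑_{i=1}^k H(X_{C_i}) − H(X_M))/(k−1). -/
open Finset

/-- Marginal pmf of `p` on the coordinates in `S`. -/
noncomputable def marg {m : ℕ} {𝒳 : Fin m → Type} [∀ i, Fintype (𝒳 i)]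
    [∀ i, DecidableEq (𝒳 i)] (p : (∀ i, 𝒳 i) → ℝ) (S : Finset (Fin m))
    (y : ∀ i : {j // j ∈ S}, 𝒳 i.1) : ℝ :=
  ∑ x : ∀ i, 𝒳 i, if ∀ i : {j // j ∈ S}, x i.1 = y i then p x else 0

/-- Shannon entropy (base 2) of the coordinates in `S`. -/
noncomputable def Hent {m : ℕ} {𝒳 : Fin m → Type} [∀ i, Fintype (𝒳 i)]
    [∀ i, DecidableEq (𝒳 i)] (p : (∀ i, 𝒳 i) → ℝ) (S : Finset (Fin m)) : ℝ :=
  -∑ y : ∀ i : {j // j ∈ S}, 𝒳 i.1, marg p S y * Real.logb 2 (marg p S y)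

/-- The conditional entropy function `h(B) = H(X_M) - H(X_{Bᶜ}) = H(X_B | X_{Bᶜ})`. -/
noncomputable def condh {m : ℕ} {𝒳 : Fin m → Type} [∀ i, Fintype (𝒳 i)]
    [∀ i, DecidableEq (𝒳 i)] (p : (∀ i, 𝒳 i) → ℝ) (B : Finset (Fin m)) : ℝ :=
  Hent p Finset.univ - Hent p Bᶜ

/-- Conditional entropy `H(X_S | X_U) = H(X_{S ∪ U}) - H(X_U)`. -/
noncomputable def condEnt {m : ℕ} {𝒳 : Fin m → Type} [∀ i, Fintype (𝒳 i)]
    [∀ i, DecidableEq (𝒳 i)] (p : (∀ i, 𝒳 i) → ℝ) (S U : Finset (Fin m)) : ℝ :=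
  Hent p (S ∪ U) - Hent p U

/-- `B ∈ ℬ(A)`: `B` is a nonempty proper subset of `M` not containing `A`. -/
def memB {m : ℕ} (A B : Finset (Fin m)) : Prop :=
  B.Nonempty ∧ B ⊂ Finset.univ ∧ ¬ A ⊆ B

/-- `R ∈ ℛ(A)`: the rate tuple `R` satisfies all Slepian–Wolf constraints for `A`. -/
def feasible {m : ℕ} {𝒳 : Fin m → Type} [∀ i, Fintype (𝒳 i)]
    [∀ i, DecidableEq (𝒳 i)] (p : (∀ i, 𝒳 i) → ℝ) (A : Finset (Fin m))
    (R : Fin m → ℝ) : Prop :=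
  ∀ B : Finset (Fin m), memB A B → condh p B ≤ ∑ j ∈ B, R j

/-- Smallest rate of communication for omniscience `R_CO(A)`. -/
noncomputable def RCO {m : ℕ} {𝒳 : Fin m → Type} [∀ i, Fintype (𝒳 i)]
    [∀ i, DecidableEq (𝒳 i)] (p : (∀ i, 𝒳 i) → ℝ) (A : Finset (Fin m)) : ℝ :=
  sInf {s : ℝ | ∃ R : Fin m → ℝ, feasible p A R ∧ s = ∑ j, R j}

/-- `(C 1, …, C k)` is a partition of `M` into pairwise disjoint sets. -/
def isPartition {m k : ℕ} (C : Fin k → Finset (Fin m)) : Prop :=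
  (∀ i j, i ≠ j → Disjoint (C i) (C j)) ∧ Finset.univ.biUnion C = Finset.univ

/-- Mutual dependence `I(C_1,…,C_k)` of the partitioning `C`. -/
noncomputable def Ival {m : ℕ} {𝒳 : Fin m → Type} [∀ i, Fintype (𝒳 i)]
    [∀ i, DecidableEq (𝒳 i)] (p : (∀ i, 𝒳 i) → ℝ) {k : ℕ}
    (C : Fin k → Finset (Fin m)) : ℝ :=
  ((∑ i, Hent p (C i)) - Hent p Finset.univ) / ((k : ℝ) - 1)

/-- Mutual dependence upper bound `I(A)`: minimum of `I(C_1,…,C_k)` over all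
`2 ≤ k ≤ |A|` and partitionings in `𝒫_k(A)`. -/
noncomputable def IA {m : ℕ} {𝒳 : Fin m → Type} [∀ i, Fintype (𝒳 i)]
    [∀ i, DecidableEq (𝒳 i)] (p : (∀ i, 𝒳 i) → ℝ) (A : Finset (Fin m)) : ℝ :=
  sInf {r : ℝ | ∃ k : ℕ, 2 ≤ k ∧ k ≤ A.card ∧ ∃ C : Fin k → Finset (Fin m),
    isPartition C ∧ (∀ i, (C i ∩ A).Nonempty) ∧ r = Ival p C}

/-- Summing over the complements of the `k` cells of a partition counts every index `k - 1`
times. -/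
theorem sum_sum_compl_of_isPartition {m k : ℕ} {C : Fin k → Finset (Fin m)} (hC : isPartition C)
    (R : Fin m → ℝ) :
    ∑ i, ∑ j ∈ (C i)ᶜ, R j = ((k : ℝ) - 1) * ∑ j, R j := by
  have hcells : ∑ i, ∑ j ∈ C i, R j = ∑ j, R j := by
    rw [← Finset.sum_biUnion fun i _ j _ hij => hC.1 i j hij, hC.2]
  have hcompl (i : Fin k) : ∑ j ∈ (C i)ᶜ, R j = ∑ j, R j - ∑ j ∈ C i, R j := by
    rw [← Finset.sum_add_sum_compl (C i) R, add_sub_cancel_left]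
  simp only [hcompl, Finset.sum_sub_distrib, hcells, Finset.sum_const, Finset.card_univ,
    Fintype.card_fin, nsmul_eq_mul]
  ring

/-- The complement of a cell of a partitioning in `𝒫_k(A)`, `k ≥ 2`, lies in `ℬ(A)`. -/
theorem memB_compl_of_isPartition {m k : ℕ} {A : Finset (Fin m)} {C : Fin k → Finset (Fin m)}
    (hk : 2 ≤ k) (hC : isPartition C) (hCA : ∀ i, (C i ∩ A).Nonempty) (i : Fin k) :
    memB A (C i)ᶜ := by
  obtain ⟨a, ha⟩ := hCA i
  rw [Finset.mem_inter] at ha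
  have hnot : a ∉ (C i)ᶜ := by simpa using ha.1
  have : Nontrivial (Fin k) := Fin.nontrivial_iff_two_le.mpr hk
  obtain ⟨j, hji⟩ := exists_ne i
  obtain ⟨b, hb⟩ := hCA j
  refine ⟨⟨b, ?_⟩, ?_, fun h => hnot (h ha.2)⟩
  · exact Finset.mem_compl.mpr
      (Finset.disjoint_left.mp (hC.1 j i hji) (Finset.mem_inter.mp hb).1)
  · exact Finset.ssubset_univ_iff.mpr fun h => hnot (h ▸ Finset.mem_univ a)

/-- For every `R ∈ ℛ(A)` and every partitioning `(C_1,…,C_k) ∈ 𝒫_k(A)` with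
`2 ≤ k ≤ |A|`, one has `∑_{j∈M} R_j ≥ h(M) − I(C_1,…,C_k)`. -/
theorem sum_rate_ge_of_partition {m : ℕ} (hm : 2 ≤ m) {𝒳 : Fin m → Type}
    [∀ i, Fintype (𝒳 i)] [∀ i, DecidableEq (𝒳 i)] [∀ i, Nonempty (𝒳 i)]
    (p : (∀ i, 𝒳 i) → ℝ) (hp0 : ∀ x, 0 ≤ p x) (hp1 : ∑ x, p x = 1)
    (A : Finset (Fin m)) (hA : 2 ≤ A.card)
    (R : Fin m → ℝ) (hR : feasible p A R)
    (k : ℕ) (hk2 : 2 ≤ k) (hkA : k ≤ A.card)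
    (C : Fin k → Finset (Fin m)) (hC : isPartition C)
    (hCA : ∀ i, (C i ∩ A).Nonempty) :
    Hent p Finset.univ - Ival p C ≤ ∑ j, R j := by
  have hsum : ∑ i, condh p (C i)ᶜ ≤ ((k : ℝ) - 1) * ∑ j, R j := by
    rw [← sum_sum_compl_of_isPartition hC]
    exact Finset.sum_le_sum fun i _ => hR _ (memB_compl_of_isPartition hk2 hC hCA i)
  simp only [condh, compl_compl, Finset.sum_sub_distrib, Finset.sum_const, Finset.card_univ,
    Fintype.card_fin, nsmul_eq_mul] at hsum
  have hk : (0 : ℝ) < (k : ℝ) - 1 := by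
    have : (2 : ℝ) ≤ k := by exact_mod_cast hk2
    linarith
  rw [Ival, sub_le_comm, le_div_iff₀ hk]
  linarith
end

section
/- (Main theorem, all users active.) When A = M, the mutual dependence upper bound is tight: R_CO(M) = h(M) − I(M). Explicitly, inf{ ∑_{j∈M} R_j : R ∈ ℝ^M, ∑_{j∈B} R_j ≥ H(X_M) − H(X_{B^c}) for every nonempty proper subset B ⊊ M } = H(X_M) − min{ (∑_{i=1}^k H(X_{C_i}) − H(X_M))/(k−1) : 2 ≤ k ≤ m, (C_1,…,C_k) a partition of M into k nonempty pairwise disjoint sets }. -/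
open Finset

section Entropy

variable {Ω α β δ : Type*} [Fintype Ω] [Fintype α] [DecidableEq α] [Fintype β] [DecidableEq β]
  [DecidableEq δ]

/-- Mass function of the image of `p` under `X`. -/
def pushMass (p : Ω → ℝ) (X : Ω → δ) (a : δ) : ℝ :=
  ∑ ω, if X ω = a then p ω else 0

lemma pushMass_nonneg {p : Ω → ℝ} (hp : ∀ ω, 0 ≤ p ω) (X : Ω → δ) (a : δ) :
    0 ≤ pushMass p X a :=
  sum_nonneg fun ω _ => by split_ifs <;> simp [hp]

lemma le_pushMass_apply {p : Ω → ℝ} (hp : ∀ ω, 0 ≤ p ω) (X : Ω → δ) (ω : Ω) :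
    p ω ≤ pushMass p X (X ω) := by
  have h := single_le_sum (f := fun ω' => if X ω' = X ω then p ω' else 0)
    (fun ω' _ => by split_ifs <;> simp [hp]) (mem_univ ω)
  simpa [pushMass] using h

lemma sum_pushMass_mul (p : Ω → ℝ) (X : Ω → α) (g : α → ℝ) :
    ∑ a, pushMass p X a * g a = ∑ ω, p ω * g (X ω) := by
  simp only [pushMass, sum_mul, ite_mul, zero_mul]
  rw [sum_comm]
  simp

lemma sum_ite_pushMass (p : Ω → ℝ) (Y : Ω → β) (d : β → δ) (c : δ) :
    ∑ v, (if d v = c then pushMass p Y v else 0) = pushMass p (d ∘ Y) c := by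
  have h := sum_pushMass_mul p Y (fun v => if d v = c then 1 else 0)
  simpa [pushMass] using h

lemma sum_mul_div_pushMass_le {p : Ω → ℝ} (hp : ∀ ω, 0 ≤ p ω) (X : Ω → α) (Y : Ω → β)
    (d : α → δ) (e : β → δ) (hde : d ∘ X = e ∘ Y) :
    ∑ ω, p ω * (pushMass p X (X ω) * pushMass p Y (Y ω) /
      (pushMass p (fun ω => (X ω, Y ω)) (X ω, Y ω) * pushMass p (d ∘ X) (d (X ω)))) ≤
      ∑ ω, p ω := by
  have key := sum_pushMass_mul p (fun ω => (X ω, Y ω)) (fun w =>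
    pushMass p X w.1 * pushMass p Y w.2 /
      (pushMass p (fun ω => (X ω, Y ω)) w * pushMass p (d ∘ X) (d w.1)))
  rw [← key, Fintype.sum_prod_type]
  have hX : ∑ u, pushMass p X u = ∑ ω, p ω := by
    simpa using sum_pushMass_mul p X (fun _ => 1)
  rw [← hX]
  refine sum_le_sum fun u _ => ?_
  have hpt : ∀ v, pushMass p (fun ω => (X ω, Y ω)) (u, v) * (pushMass p X u * pushMass p Y v /
      (pushMass p (fun ω => (X ω, Y ω)) (u, v) * pushMass p (d ∘ X) (d u))) ≤
      pushMass p X u / pushMass p (d ∘ X) (d u) *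
        (if e v = d u then pushMass p Y v else 0) := by
    intro v
    have hX0 := pushMass_nonneg hp X u
    have hY0 := pushMass_nonneg hp Y v
    have hD0 := pushMass_nonneg hp (d ∘ X) (d u)
    by_cases h0 : pushMass p (fun ω => (X ω, Y ω)) (u, v) = 0
    · rw [h0, zero_mul]
      split_ifs <;> positivity
    · have huv : e v = d u := by
        by_contra hne
        refine h0 (sum_eq_zero fun ω _ => if_neg ?_)
        rintro ⟨⟩
        exact hne (congrFun hde ω).symm
      rw [if_pos huv]
      apply le_of_eq
      rw [mul_div_assoc', mul_div_mul_left _ _ h0, div_mul_eq_mul_div]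
  refine (sum_le_sum fun v _ => hpt v).trans ?_
  rw [← mul_sum, sum_ite_pushMass, ← hde, div_mul_eq_mul_div]
  exact div_le_of_le_mul₀ (pushMass_nonneg hp _ _) (pushMass_nonneg hp _ _) le_rfl

lemma sum_mul_log_pushMass_le {p : Ω → ℝ} (hp : ∀ ω, 0 ≤ p ω) (X : Ω → α) (Y : Ω → β)
    (d : α → δ) (e : β → δ) (hde : d ∘ X = e ∘ Y) :
    ∑ ω, p ω * Real.log (pushMass p X (X ω)) + ∑ ω, p ω * Real.log (pushMass p Y (Y ω)) ≤
      ∑ ω, p ω * Real.log (pushMass p (fun ω => (X ω, Y ω)) (X ω, Y ω)) +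
        ∑ ω, p ω * Real.log (pushMass p (d ∘ X) (d (X ω))) := by
  have hle := sum_mul_div_pushMass_le hp X Y d e hde
  rw [← sub_nonpos, ← sum_add_distrib, ← sum_add_distrib, ← sum_sub_distrib]
  rw [← sub_nonpos, ← sum_sub_distrib] at hle
  refine (sum_le_sum fun ω _ => ?_).trans hle
  rcases (hp ω).eq_or_lt with h | h
  · simp [← h]
  · have hX := h.trans_le (le_pushMass_apply hp X ω)
    have hY := h.trans_le (le_pushMass_apply hp Y ω)
    have hXY := h.trans_le (le_pushMass_apply hp (fun ω => (X ω, Y ω)) ω)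
    have hD : 0 < pushMass p (d ∘ X) (d (X ω)) := h.trans_le (le_pushMass_apply hp (d ∘ X) ω)
    have hlog := Real.log_le_sub_one_of_pos (div_pos (mul_pos hX hY) (mul_pos hXY hD))
    rw [Real.log_div (mul_pos hX hY).ne' (mul_pos hXY hD).ne', Real.log_mul hX.ne' hY.ne',
      Real.log_mul hXY.ne' hD.ne'] at hlog
    have := mul_le_mul_of_nonneg_left hlog h.le
    linarith

end Entropy

section Marginals

variable {m : ℕ} {𝒳 : Fin m → Type} [∀ i, Fintype (𝒳 i)] [∀ i, DecidableEq (𝒳 i)]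

lemma marg_eq_pushMass (p : (∀ i, 𝒳 i) → ℝ) (S : Finset (Fin m)) :
    marg p S = pushMass p (fun x (i : {j // j ∈ S}) => x i.1) := by
  funext y
  simp only [marg, pushMass, funext_iff]

lemma Hent_eq_sum_log (p : (∀ i, 𝒳 i) → ℝ) (S : Finset (Fin m)) :
    Hent p S = -(∑ x, p x * Real.log (marg p S fun i => x i.1)) / Real.log 2 := by
  have h := sum_pushMass_mul p (fun x (i : {j // j ∈ S}) => x i.1)
    (fun y => Real.logb 2 (marg p S y))
  rw [← marg_eq_pushMass] at h
  rw [Hent, h, neg_div, sum_div]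
  simp only [Real.logb, mul_div_assoc]

lemma Hent_submodular {p : (∀ i, 𝒳 i) → ℝ} (hp : ∀ x, 0 ≤ p x) (S T : Finset (Fin m)) :
    Hent p (S ∪ T) + Hent p (S ∩ T) ≤ Hent p S + Hent p T := by
  have h := sum_mul_log_pushMass_le hp (fun x (i : {j // j ∈ S}) => x i.1)
    (fun x (i : {j // j ∈ T}) => x i.1)
    (fun u (i : {j // j ∈ S ∩ T}) => u ⟨i.1, (mem_inter.1 i.2).1⟩)
    (fun v (i : {j // j ∈ S ∩ T}) => v ⟨i.1, (mem_inter.1 i.2).2⟩) rfl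
  have hU : ∀ x : ∀ i, 𝒳 i, pushMass p (fun x =>
      ((fun (i : {j // j ∈ S}) => x i.1), (fun (i : {j // j ∈ T}) => x i.1)))
      ((fun i => x i.1), (fun i => x i.1)) = marg p (S ∪ T) (fun i => x i.1) := by
    intro x
    refine sum_congr rfl fun x' _ => if_congr ?_ rfl rfl
    simp only [Prod.mk.injEq, funext_iff, Subtype.forall, mem_union, or_imp, forall_and]
  have hI : ∀ x : ∀ i, 𝒳 i, marg p (S ∩ T) (fun i => x i.1) = pushMass p
      ((fun (u : ∀ i : {j // j ∈ S}, 𝒳 i.1) (i : {j // j ∈ S ∩ T}) =>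
        u ⟨i.1, (mem_inter.1 i.2).1⟩) ∘ (fun (x : ∀ i, 𝒳 i) (i : {j // j ∈ S}) => x i.1)) (fun i => x i.1) := by
    intro x
    rw [marg_eq_pushMass]
    rfl
  simp only [hU, ← hI, ← marg_eq_pushMass] at h
  simp only [Hent_eq_sum_log, ← add_div]
  have := Real.log_pos one_lt_two
  gcongr ?_ / _
  linarith

end Marginals

section DilworthTruncation

variable {α : Type*} [DecidableEq α] (g : Finset α → ℝ)

lemma exists_le_with_tight [Fintype α] (J : Finset α) :
    ∃ R : α → ℝ, (∀ S : Finset α, S.Nonempty → ∑ j ∈ S, R j ≤ g S) ∧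
      ∀ j ∈ J, ∃ S : Finset α, j ∈ S ∧ ∑ i ∈ S, R i = g S := by
  induction J using Finset.induction_on with
  | empty =>
    refine ⟨fun _ => -∑ S, |g S|, fun S hS => ?_, by simp⟩
    have h1 : |g S| ≤ ∑ S, |g S| := single_le_sum (fun S _ => abs_nonneg (g S)) (mem_univ S)
    have h2 : (1 : ℝ) ≤ #S := by exact_mod_cast hS.card_pos
    have h3 := neg_abs_le (g S)
    have h4 := abs_nonneg (g S)
    simp only [sum_const, nsmul_eq_mul]
    nlinarith
  | insert a J _ ih =>
    obtain ⟨R, hR, hJ⟩ := ih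
    obtain ⟨T, hT, hmin⟩ := exists_min_image (univ.filter fun S : Finset α => a ∈ S)
      (fun S => g S - ∑ i ∈ S, R i) ⟨{a}, by simp⟩
    simp only [mem_filter, mem_univ, true_and] at hT hmin
    set ε := g T - ∑ i ∈ T, R i with hε
    have hε0 : 0 ≤ ε := sub_nonneg.2 (hR T ⟨a, hT⟩)
    have hsum : ∀ S : Finset α, ∑ i ∈ S, (R i + if i = a then ε else 0) =
        ∑ i ∈ S, R i + if a ∈ S then ε else 0 := fun S => by
      rw [sum_add_distrib, sum_ite_eq']
    refine ⟨fun i => R i + if i = a then ε else 0, fun S hS => ?_, fun j hj => ?_⟩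
    · rw [hsum]
      split_ifs with h
      · linarith [hmin S h]
      · linarith [hR S hS]
    · rcases mem_insert.1 hj with rfl | hj
      · exact ⟨T, hT, by rw [hsum, if_pos hT, hε]; ring⟩
      · obtain ⟨S, hS, hS'⟩ := hJ j hj
        refine ⟨S, hS, ?_⟩
        rw [hsum, hS']
        split_ifs with h
        · linarith [hmin S h]
        · ring

variable {g}

lemma tight_union {R : α → ℝ}
    (hg : ∀ S T : Finset α, (S ∩ T).Nonempty → g (S ∪ T) + g (S ∩ T) ≤ g S + g T)
    (hR : ∀ S : Finset α, S.Nonempty → ∑ j ∈ S, R j ≤ g S) {S T : Finset α}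
    (hST : (S ∩ T).Nonempty) (hS : ∑ j ∈ S, R j = g S) (hT : ∑ j ∈ T, R j = g T) :
    ∑ j ∈ S ∪ T, R j = g (S ∪ T) := by
  have h1 := hR _ hST
  have h2 := hR (S ∪ T) (hST.mono (inter_subset_left.trans subset_union_left))
  have h3 := sum_union_inter (s₁ := S) (s₂ := T) (f := R)
  linarith [hg S T hST]

lemma exists_tight_partition [Fintype α]
    (hg : ∀ S T : Finset α, (S ∩ T).Nonempty → g (S ∪ T) + g (S ∩ T) ≤ g S + g T) :
    ∃ R : α → ℝ, (∀ S : Finset α, S.Nonempty → ∑ j ∈ S, R j ≤ g S) ∧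
      ∃ T : α → Finset α, (∀ j, j ∈ T j) ∧ (∀ j, ∑ i ∈ T j, R i = g (T j)) ∧
        ∀ j k, T j ≠ T k → Disjoint (T j) (T k) := by
  obtain ⟨R, hR, hJ⟩ := exists_le_with_tight g univ
  refine ⟨R, hR, ?_⟩
  have hmax : ∀ j, ∃ T : Finset α, (j ∈ T ∧ ∑ i ∈ T, R i = g T) ∧
      ∀ S : Finset α, j ∈ S → ∑ i ∈ S, R i = g S → S ⊆ T := by
    intro j
    obtain ⟨S₀, hj, hS₀⟩ := hJ j (mem_univ j)
    have hne : (univ.filter fun S : Finset α => j ∈ S ∧ ∑ i ∈ S, R i = g S).Nonempty :=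
      ⟨S₀, by simp [hj, hS₀]⟩
    refine ⟨sup' _ hne id, ?_, fun S h1 h2 => le_sup' id (by simp [h1, h2])⟩
    refine sup'_induction (p := fun S : Finset α => j ∈ S ∧ ∑ i ∈ S, R i = g S) hne id ?_
      (fun S hS => (mem_filter.1 hS).2)
    exact fun S hS T hT => ⟨mem_union_left _ hS.1,
      tight_union hg hR ⟨j, mem_inter.2 ⟨hS.1, hT.1⟩⟩ hS.2 hT.2⟩
  choose T hT hTmax using hmax
  refine ⟨T, fun j => (hT j).1, fun j => (hT j).2, fun j k hne => ?_⟩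
  by_contra hd
  have hu := tight_union hg hR (not_disjoint_iff_nonempty_inter.1 hd) (hT j).2 (hT k).2
  have hj := hTmax j _ (mem_union_left _ (hT j).1) hu
  have hk := hTmax k _ (mem_union_right _ (hT k).1) hu
  exact hne ((subset_union_left.trans hk).antisymm (subset_union_right.trans hj))

/-- If every partition into at least two blocks has `g`-value at least `g univ`, then the
intersecting submodular function `g` dominates a modular function with the same total. -/
lemma exists_le_sum_eq_univ [Fintype α] [Nonempty α]
    (hg : ∀ S T : Finset α, (S ∩ T).Nonempty → g (S ∪ T) + g (S ∩ T) ≤ g S + g T)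
    (hpart : ∀ P : Finset (Finset α), 2 ≤ #P → (∀ C ∈ P, C.Nonempty) →
      (P : Set (Finset α)).PairwiseDisjoint id → P.biUnion id = univ →
      g univ ≤ ∑ C ∈ P, g C) :
    ∃ R : α → ℝ, (∀ S : Finset α, S.Nonempty → ∑ j ∈ S, R j ≤ g S) ∧
      ∑ j, R j = g univ := by
  obtain ⟨R, hR, T, hT, hRT, hdisj⟩ := exists_tight_partition hg
  refine ⟨R, hR, (hR univ univ_nonempty).antisymm ?_⟩
  have hcover : (univ.image T).biUnion id = univ := by
    ext j
    simpa using ⟨j, hT j⟩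
  have hpd : ((univ.image T : Finset (Finset α)) : Set (Finset α)).PairwiseDisjoint id := by
    intro A hA B hB hAB
    obtain ⟨j, -, rfl⟩ := mem_image.1 (mem_coe.1 hA)
    obtain ⟨k, -, rfl⟩ := mem_image.1 (mem_coe.1 hB)
    exact hdisj j k hAB
  rcases le_or_gt 2 #(univ.image T) with h2 | h2
  · have h := hpart _ h2 (fun C hC => by
      obtain ⟨j, -, rfl⟩ := mem_image.1 hC
      exact ⟨j, hT j⟩) hpd hcover
    rw [← hcover, sum_biUnion hpd, hcover]
    refine h.trans_eq (sum_congr rfl fun C hC => ?_)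
    obtain ⟨j, -, rfl⟩ := mem_image.1 hC
    exact (hRT j).symm
  · have hone : ∀ j k, T j = T k := fun j k =>
      card_le_one.1 (Nat.lt_succ_iff.1 h2) _ (mem_image_of_mem T (mem_univ j)) _
        (mem_image_of_mem T (mem_univ k))
    obtain ⟨j⟩ := ‹Nonempty α›
    have huniv : T j = univ := eq_univ_of_forall fun k => hone k j ▸ hT k
    rw [← huniv, hRT j]

end DilworthTruncation

section Omniscience

variable {m : ℕ} {𝒳 : Fin m → Type} [∀ i, Fintype (𝒳 i)] [∀ i, DecidableEq (𝒳 i)]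
  {p : (∀ i, 𝒳 i) → ℝ}

lemma isPartition.sum_sum_eq {k : ℕ} {C : Fin k → Finset (Fin m)} (hC : isPartition C)
    (R : Fin m → ℝ) : ∑ i, ∑ j ∈ C i, R j = ∑ j, R j := by
  rw [← hC.2, sum_biUnion fun i _ j _ hij => hC.1 i j hij]

lemma sub_sum_le_Ival {R : Fin m → ℝ} (hR : feasible p univ R) {k : ℕ} (hk : 2 ≤ k)
    {C : Fin k → Finset (Fin m)} (hC : isPartition C) (hne : ∀ i, (C i).Nonempty) :
    Hent p univ - ∑ j, R j ≤ Ival p C := by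
  have hk' : (2 : ℝ) ≤ k := by exact_mod_cast hk
  have hblock : ∀ i, ∑ j ∈ C i, R j ≤ Hent p (C i) - (Hent p univ - ∑ j, R j) := by
    intro i
    have : Nontrivial (Fin k) := Fin.nontrivial_iff_two_le.2 hk
    obtain ⟨l, hl⟩ := exists_ne i
    have hcne : (C i)ᶜ.Nonempty := (hne l).mono
      (subset_compl_iff_disjoint_right.2 (hC.1 l i hl))
    have hcss : (C i)ᶜ ≠ univ := fun h => (hne i).ne_empty (by simpa using h)
    have h := hR (C i)ᶜ ⟨hcne, ssubset_univ_iff.2 hcss,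
      fun h => hcss (univ_subset_iff.1 h)⟩
    rw [condh, compl_compl] at h
    have := sum_add_sum_compl (C i) R
    linarith
  have h := sum_le_sum fun i (_ : i ∈ univ) => hblock i
  rw [hC.sum_sum_eq, sum_sub_distrib, sum_const, card_univ, Fintype.card_fin,
    nsmul_eq_mul] at h
  rw [Ival, le_div_iff₀ (by linarith)]
  linarith

lemma feasible_of_sum_le {R : Fin m → ℝ} {b : ℝ}
    (hR : ∀ S : Finset (Fin m), S.Nonempty → ∑ j ∈ S, R j ≤ Hent p S - b)
    (hsum : ∑ j, R j = Hent p univ - b) : feasible p univ R := by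
  rintro B ⟨-, hB, -⟩
  have hne : Bᶜ.Nonempty := by
    rw [nonempty_iff_ne_empty, Ne, compl_eq_empty_iff]
    exact hB.ne
  have h1 := hR _ hne
  have h2 := sum_add_sum_compl B R
  rw [condh]
  linarith

end Omniscience

/-- **Main theorem (all users active).** When `A = M`, the mutual dependence upper
bound is tight: `R_CO(M) = h(M) − I(M)`. -/
theorem tightness_all_active {m : ℕ} (hm : 2 ≤ m) {𝒳 : Fin m → Type}
    [∀ i, Fintype (𝒳 i)] [∀ i, DecidableEq (𝒳 i)] [∀ i, Nonempty (𝒳 i)]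
    (p : (∀ i, 𝒳 i) → ℝ) (hp0 : ∀ x, 0 ≤ p x) (hp1 : ∑ x, p x = 1) :
    RCO p (Finset.univ : Finset (Fin m)) =
      Hent p Finset.univ - IA p (Finset.univ : Finset (Fin m)) := by
  have : Nonempty (Fin m) := ⟨⟨0, by omega⟩⟩
  set V : Set ℝ := {r | ∃ k : ℕ, 2 ≤ k ∧ k ≤ (univ : Finset (Fin m)).card ∧
    ∃ C : Fin k → Finset (Fin m),
      isPartition C ∧ (∀ i, (C i ∩ univ).Nonempty) ∧ r = Ival p C}
  have hIA : IA p univ = sInf V := rfl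
  have hVne : V.Nonempty := by
    refine ⟨_, m, hm, by simp, fun i => {i}, ⟨fun i j hij => by simpa using hij, ?_⟩,
      by simp, rfl⟩
    ext i
    simp
  have hlower : ∀ R : Fin m → ℝ, feasible p univ R →
      Hent p univ - ∑ j, R j ∈ lowerBounds V := by
    rintro R hR _ ⟨k, hk, -, C, hC, hne, rfl⟩
    exact sub_sum_le_Ival hR hk hC fun i => by simpa using hne i
  have hVbdd : BddBelow V := by
    have hfin : V.Finite := by
      refine ((Set.finite_Iic (Fintype.card (Fin m))).biUnion fun k _ =>
        Set.finite_range fun C : Fin k → Finset (Fin m) => Ival p C).subset ?_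
      rintro _ ⟨k, -, hk, C, -, -, rfl⟩
      exact Set.mem_biUnion hk ⟨C, rfl⟩
    exact hfin.bddBelow
  obtain ⟨R, hR, hsum⟩ := exists_le_sum_eq_univ (g := fun S => Hent p S - sInf V)
    (fun S T _ => by linarith [Hent_submodular hp0 S T]) (by
      intro P hP hne hdisj hcover
      have hP' : (2 : ℝ) ≤ #P := by exact_mod_cast hP
      let C : Fin #P → Finset (Fin m) := fun i => (P.equivFin.symm i).1
      have hsumC : ∑ i, Hent p (C i) = ∑ S ∈ P, Hent p S := by
        rw [← sum_coe_sort P, ← P.equivFin.symm.sum_comp]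
      have hmem : Ival p C ∈ V := by
        refine ⟨#P, hP, ?_, C, ⟨fun i j hij => ?_, ?_⟩, fun i => ?_, rfl⟩
        · rw [← hcover, card_biUnion hdisj, card_eq_sum_ones]
          exact sum_le_sum fun S hS => (hne S hS).card_pos
        · refine hdisj (P.equivFin.symm i).2 (P.equivFin.symm j).2 fun h => hij ?_
          exact P.equivFin.symm.injective (Subtype.ext h)
        · refine eq_univ_of_forall fun j => ?_
          obtain ⟨S, hS, hj⟩ := mem_biUnion.1 (hcover ▸ mem_univ j)
          exact mem_biUnion.2 ⟨P.equivFin ⟨S, hS⟩, mem_univ _, by simpa [C] using hj⟩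
        · simpa using hne _ (P.equivFin.symm i).2
      have hle := csInf_le hVbdd hmem
      rw [Ival, le_div_iff₀ (by linarith), hsumC] at hle
      rw [sum_sub_distrib, sum_const, nsmul_eq_mul]
      linarith)
  have hleast : IsLeast {s : ℝ | ∃ R : Fin m → ℝ, feasible p univ R ∧ s = ∑ j, R j}
      (Hent p univ - sInf V) := by
    refine ⟨⟨R, feasible_of_sum_le hR hsum, hsum.symm⟩, ?_⟩
    rintro _ ⟨R', hR', rfl⟩
    linarith [le_csInf hVne (hlower R' hR')]
  rw [hIA]
  exact hleast.csInf_eq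
end

section
/- Let M be a finite set, ℬ a finite family of subsets of M, and y : ℬ → ℝ with y_B ≥ 0 for all B ∈ ℬ and ∑_{B∈ℬ : j∈B} y_B = 1 for every j ∈ M. For j ∈ M define the support pattern S_j := {B ∈ ℬ : y_B > 0 and j ∈ B}. Then for all j, j' ∈ M, if S_j ⊆ S_{j'} then S_j = S_{j'} (no support pattern can strictly contain another). -/
open Finset

/-- No support pattern of a dual-feasible weight vector can strictly contain another:
if `y ≥ 0` on the family `ℬ` of subsets of `M` and `∑_{B ∈ ℬ, j ∈ B} y_B = 1` for every
`j ∈ M`, then `S_j ⊆ S_{j'}` implies `S_j = S_{j'}`, where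
`S_j = {B ∈ ℬ : y_B > 0 and j ∈ B}`. -/
theorem support_pattern_no_strict_containment {α : Type} [DecidableEq α]
    (M : Finset α) (hM : M.Nonempty) (ℬ : Finset (Finset α))
    (hℬ : ∀ B ∈ ℬ, B ⊆ M) (y : Finset α → ℝ)
    (hy0 : ∀ B ∈ ℬ, 0 ≤ y B)
    (hy1 : ∀ j ∈ M, ∑ B ∈ ℬ.filter (fun B => j ∈ B), y B = 1) :
    ∀ j ∈ M, ∀ j' ∈ M,
      {B | B ∈ ℬ ∧ 0 < y B ∧ j ∈ B} ⊆ {B | B ∈ ℬ ∧ 0 < y B ∧ j' ∈ B} →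
      {B | B ∈ ℬ ∧ 0 < y B ∧ j ∈ B} = {B | B ∈ ℬ ∧ 0 < y B ∧ j' ∈ B} := by
  intro j hj j' hj' h
  have hle : ∀ B ∈ ℬ, (if j ∈ B then y B else 0) ≤ if j' ∈ B then y B else 0 := by
    intro B hB
    have hnonneg := hy0 B hB
    rcases hnonneg.eq_or_lt with hzero | hpos
    · simp [← hzero]
    · by_cases hjB : j ∈ B
      · have hj'B : j' ∈ B := (h ⟨hB, hpos, hjB⟩).2.2
        simp [hjB, hj'B]
      · rw [if_neg hjB]
        split_ifs <;> simp [hnonneg]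
  have hsum : ∑ B ∈ ℬ, (if j ∈ B then y B else 0) = ∑ B ∈ ℬ, if j' ∈ B then y B else 0 := by
    rw [← sum_filter, ← sum_filter, hy1 j hj, hy1 j' hj']
  have heq := (sum_eq_sum_iff_of_le hle).1 hsum
  refine h.antisymm ?_
  rintro B ⟨hB, hpos, hj'B⟩
  refine ⟨hB, hpos, ?_⟩
  by_contra hjB
  have hzero := heq B hB
  rw [if_neg hjB, if_pos hj'B] at hzero
  exact hpos.ne hzero
end

section
/- For the XOR counter-example source, the conditional entropy function satisfies: h(B) = 0 for every B ⊆ M with |B| ∈ {1, 2}; h(B) = 1 for every B ⊆ M with |B| = 4; and h(B) = 2 for every B ⊆ M with |B| = 5. -/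
open Finset

/-- The XOR map defining the counter-example source: `X_1 = Y_1 ⊕ Y_3`,
`X_2 = Y_1 ⊕ Y_4`, `X_3 = Y_3 ⊕ Y_4`, `X_4 = Y_2 ⊕ Y_3`, `X_5 = Y_2 ⊕ Y_4`,
`X_6 = Y_1 ⊕ Y_2` (indices shifted to start from `0`). -/
def xorMap (y : Fin 4 → ZMod 2) : Fin 6 → ZMod 2 :=
  ![y 0 + y 2, y 0 + y 3, y 2 + y 3, y 1 + y 2, y 1 + y 3, y 0 + y 1]

/-- The joint pmf of the counter-example source: the pushforward under `xorMap`
of the uniform distribution on `𝔽₂⁴`. -/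
noncomputable def xorP (x : Fin 6 → ZMod 2) : ℝ :=
  ((Finset.univ.filter (fun y : Fin 4 → ZMod 2 => xorMap y = x)).card : ℝ) / 16

/-- The inputs on which all the coordinates of `xorMap` in `S` vanish. -/
def xorKer (S : Finset (Fin 6)) : Finset (Fin 4 → ZMod 2) :=
  univ.filter fun z => ∀ i ∈ S, xorMap z i = 0

lemma xorMap_sub (y z : Fin 4 → ZMod 2) : xorMap (y - z) = xorMap y - xorMap z := by
  ext i
  fin_cases i <;> simp [xorMap] <;> ring

lemma marg_xorP (S : Finset (Fin 6)) (y : {j // j ∈ S} → ZMod 2) :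
    marg xorP S y =
      ((univ.filter fun z => ∀ i : {j // j ∈ S}, xorMap z i.1 = y i).card : ℝ) / 16 := by
  have h (x : Fin 6 → ZMod 2) :
      (if ∀ i : {j // j ∈ S}, x i.1 = y i then xorP x else 0) =
        ∑ z, if xorMap z = x then
          (if ∀ i : {j // j ∈ S}, x i.1 = y i then (1 / 16 : ℝ) else 0) else 0 := by
    split_ifs
    · rw [xorP, ← sum_filter, sum_const, nsmul_eq_mul, mul_one_div]
    · simp
  unfold marg
  simp_rw [h]
  rw [sum_comm]
  simp only [sum_ite_eq, mem_univ, if_true]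
  rw [← sum_filter, sum_const, nsmul_eq_mul, mul_one_div]

lemma card_filter_xorMap_eq (S : Finset (Fin 6)) (w : Fin 4 → ZMod 2) :
    (univ.filter fun z => ∀ i : {j // j ∈ S}, xorMap z i.1 = xorMap w i.1).card =
      (xorKer S).card := by
  refine card_equiv (Equiv.subRight w) fun z => ?_
  simp [xorKer, xorMap_sub, sub_eq_zero]

lemma Hent_xorP (S : Finset (Fin 6)) :
    Hent xorP S = -Real.logb 2 ((xorKer S).card / 16) := by
  have h (y : {j // j ∈ S} → ZMod 2) :
      marg xorP S y * Real.logb 2 (marg xorP S y) =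
        ∑ z, if (fun i : {j // j ∈ S} => xorMap z i.1) = y then
          1 / 16 * Real.logb 2 (marg xorP S y) else 0 := by
    rw [← sum_filter, sum_const, nsmul_eq_mul, ← mul_assoc, mul_one_div]
    simp_rw [funext_iff]
    rw [← marg_xorP]
  unfold Hent
  simp_rw [h]
  rw [sum_comm]
  simp only [sum_ite_eq, mem_univ, if_true, marg_xorP, card_filter_xorMap_eq]
  simp [ZMod.card]

lemma Hent_xorP_of_card_xorKer {S : Finset (Fin 6)} {k : ℕ} (h : (xorKer S).card = 2 ^ k) :
    Hent xorP S = 4 - k := by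
  have h16 : (16 : ℝ) = 2 ^ 4 := by norm_num
  rw [Hent_xorP, h, h16, Real.logb_div (by positivity) (by norm_num)]
  simp [Real.logb_pow]

lemma card_xorKer_compl : ∀ B : Finset (Fin 6),
    (B.card ≤ 2 → (xorKer Bᶜ).card = 2 ^ 1) ∧ (B.card = 4 → (xorKer Bᶜ).card = 2 ^ 2) ∧
      (B.card = 5 → (xorKer Bᶜ).card = 2 ^ 3) := by
  decide +kernel

/-- For the XOR counter-example source, the conditional entropy function satisfies
`h(B) = 0` when `|B| ∈ {1,2}`, `h(B) = 1` when `|B| = 4`, and `h(B) = 2` when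
`|B| = 5`. -/
theorem xor_condh_values :
    (∀ B : Finset (Fin 6), (B.card = 1 ∨ B.card = 2) → condh xorP B = 0) ∧
    (∀ B : Finset (Fin 6), B.card = 4 → condh xorP B = 1) ∧
    (∀ B : Finset (Fin 6), B.card = 5 → condh xorP B = 2) := by
  have huniv : Hent xorP univ = 3 := by
    rw [← compl_empty, Hent_xorP_of_card_xorKer ((card_xorKer_compl ∅).1 (by simp))]
    norm_num
  refine ⟨fun B hB => ?_, fun B hB => ?_, fun B hB => ?_⟩ <;> rw [condh, huniv]
  · rw [Hent_xorP_of_card_xorKer ((card_xorKer_compl B).1 (by omega))]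
    norm_num
  · rw [Hent_xorP_of_card_xorKer ((card_xorKer_compl B).2.1 hB)]
    norm_num
  · rw [Hent_xorP_of_card_xorKer ((card_xorKer_compl B).2.2 hB)]
    norm_num
end
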